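/- arXiv:cond-mat/0403477 — 6 statements merged into one kernel-verified Lean document; each statement's English description precedes it below -/
import Mathlib

section
/- Let n, d be positive integers with d ≤ n, and let Y, Z be real n×d matrices such that Y Yᵀ = Z Zᵀ. Then there exists a real orthogonal d×d matrix Q (Q Qᵀ = I_d) such that Y = Z Q. -/
open Matrix

theorem aux_exists_isometry {E V : Type*} [AddCommGroup E] [Module ℝ E]
    [NormedAddCommGroup V] [InnerProductSpace ℝ V] [FiniteDimensional ℝ V]
    (f g : E →ₗ[ℝ] V) (h : ∀ x, ‖f x‖ = ‖g x‖) : ∃ L : V →ₗᵢ[ℝ] V, ∀ x, L (f x) = g x := by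
  obtain ⟨s, hs⟩ := f.rangeRestrict.exists_rightInverse_of_surjective f.range_rangeRestrict
  have hs' : ∀ y, f (s y) = y := fun y => by
    have := congrArg Subtype.val (LinearMap.congr_fun hs y)
    simpa using this
  let L0 : LinearMap.range f →ₗᵢ[ℝ] V :=
    { toLinearMap := g ∘ₗ s
      norm_map' := fun y => by
        rw [LinearMap.comp_apply, ← h, hs']
        rfl }
  refine ⟨L0.extend, fun x => ?_⟩
  have h1 := L0.extend_apply ⟨f x, LinearMap.mem_range_self f x⟩
  refine h1.trans ?_
  change g (s _) = g x
  rw [← sub_eq_zero, ← map_sub, ← norm_eq_zero, ← h, map_sub, hs', sub_self, norm_zero]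

/-- If `Y Yᵀ = Z Zᵀ` for real `n × d` matrices `Y, Z`, then there is a real orthogonal
`d × d` matrix `Q` with `Y = Z * Q`. -/
theorem exists_orthogonal_of_mul_transpose_eq (n d : ℕ) (hn : 0 < n) (hd : 0 < d) (hdn : d ≤ n)
    (Y Z : Matrix (Fin n) (Fin d) ℝ) (h : Y * Yᵀ = Z * Zᵀ) :
    ∃ Q : Matrix (Fin d) (Fin d) ℝ, Q * Qᵀ = 1 ∧ Qᵀ * Q = 1 ∧ Y = Z * Q := by
  have key : ∀ (A : Matrix (Fin n) (Fin d) ℝ) (x : EuclideanSpace ℝ (Fin n)),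
      ‖Matrix.toEuclideanLin Aᵀ x‖ ^ 2 = x.ofLp ⬝ᵥ ((A * Aᵀ) *ᵥ x.ofLp) := by
    intro A x
    rw [← Matrix.mulVec_mulVec, Matrix.dotProduct_mulVec, ← Matrix.mulVec_transpose,
      EuclideanSpace.real_norm_sq_eq]
    simp [dotProduct, Matrix.toLpLin_apply, sq]
  obtain ⟨L, hL⟩ := aux_exists_isometry (Matrix.toEuclideanLin Zᵀ) (Matrix.toEuclideanLin Yᵀ)
    (fun x => by
      rw [← sq_eq_sq₀ (norm_nonneg _) (norm_nonneg _), key, key, h])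
  let M : Matrix (Fin d) (Fin d) ℝ :=
    Matrix.of fun i j => L (EuclideanSpace.single j 1) i
  have hM : ∀ v, L v = Matrix.toEuclideanLin M v := by
    intro v
    have : L.toLinearMap = Matrix.toEuclideanLin M := by
      refine (EuclideanSpace.basisFun (Fin d) ℝ).toBasis.ext fun j => ?_
      ext i
      simp [M, Matrix.toLpLin_apply]
    exact LinearMap.congr_fun this v
  have h1 : Mᵀ * M = 1 := by
    ext i j
    have := L.inner_map_map (EuclideanSpace.single i 1) (EuclideanSpace.single j 1)
    rw [EuclideanSpace.inner_single_left, PiLp.inner_apply] at this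
    simp only [Matrix.mul_apply, Matrix.transpose_apply, M, Matrix.one_apply, Matrix.of_apply]
    simpa [mul_comm, Pi.single_apply] using this
  refine ⟨Mᵀ, by simpa using h1, by simpa using mul_eq_one_comm.mp h1, ?_⟩
  have h2 : M * Zᵀ = Yᵀ := by
    ext i j
    have := congrArg (fun v => v.ofLp i) (hL (EuclideanSpace.single j 1))
    rw [hM] at this
    simpa [Matrix.toLpLin_apply, Matrix.mul_apply, Matrix.mulVec, dotProduct] using this
  rw [← Matrix.transpose_transpose Y, ← h2, Matrix.transpose_mul, Matrix.transpose_transpose]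
end

section
/- Let n, d be positive integers with d ≤ n. Consider the right action of the orthogonal group O_d on T_{n,d} given by (Y,Q) ↦ YQ, let M_{n,d} = T_{n,d}/O_d be the quotient space of orbits equipped with the quotient topology, and let π : T_{n,d} → M_{n,d} be the canonical projection. Then the map Ψ : M_{n,d} → C_{n,d} given by Ψ([Y]) = Y Yᵀ is well defined (it does not depend on the orbit representative) and is a homeomorphism from M_{n,d} onto C_{n,d}. -/
open Matrix

lemma aux_factor {n d : ℕ} (X : Matrix (Fin n) (Fin n) ℝ) (hX : X.PosSemidef)
    (hr : X.rank ≤ d) : ∃ Y : Matrix (Fin n) (Fin d) ℝ, Y * Yᵀ = X := by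
  classical
  have hH := hX.isHermitian
  rw [hH.rank_eq_card_non_zero_eigs] at hr
  obtain ⟨e⟩ : Nonempty ({i // hH.eigenvalues i ≠ 0} ↪ Fin d) :=
    Function.Embedding.nonempty_of_card_le (by simpa using hr)
  let P : Matrix {i // hH.eigenvalues i ≠ 0} (Fin d) ℝ :=
    (1 : Matrix (Fin d) (Fin d) ℝ).submatrix e id
  have hP : P * Pᵀ = 1 := by
    have : Pᵀ = (1 : Matrix (Fin d) (Fin d) ℝ).submatrix id e := by
      simp [P, transpose_submatrix]
    rw [this, ← submatrix_mul _ _ _ _ _ Function.bijective_id, one_mul,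
      submatrix_one_embedding]
  obtain ⟨U, hU⟩ : ∃ U : Matrix (Fin n) (Fin n) ℝ, X = U * diagonal hH.eigenvalues * Uᵀ := by
    refine ⟨(hH.eigenvectorUnitary : Matrix (Fin n) (Fin n) ℝ), ?_⟩
    conv_lhs => rw [hH.spectral_theorem, Unitary.conjStarAlgAut_apply]
    rfl
  have hnn := hX.eigenvalues_nonneg
  generalize hH.eigenvalues = ev at *
  let V : Matrix (Fin n) {i // ev i ≠ 0} ℝ := Matrix.of fun i k => U i k * √(ev k)
  have hV : V * Vᵀ = X := by
    ext i j
    rw [hU, mul_apply, mul_apply]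
    have hterm : ∀ k : {i // ev i ≠ 0}, V i k * Vᵀ k j = U i k * ev k * U j k := by
      intro k
      have := Real.mul_self_sqrt (hnn k)
      change U i k * √(ev k) * (U j k * √(ev k)) = _
      linear_combination U i k * U j k * this
    rw [Finset.sum_congr rfl fun k _ => hterm k]
    simp only [mul_diagonal, transpose_apply]
    rw [← Finset.sum_subtype (Finset.univ.filter fun k => ev k ≠ 0)
      (p := fun k => ev k ≠ 0) (fun x => by simp)
      (fun k : Fin n => U i k * ev k * U j k)]
    apply Finset.sum_subset (Finset.subset_univ _)
    intro k _ hk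
    have hk0 : ev k = 0 := by simpa using hk
    simp [hk0]
  refine ⟨V * P, ?_⟩
  rw [transpose_mul, Matrix.mul_assoc, ← Matrix.mul_assoc P, hP, Matrix.one_mul, hV]

lemma aux_norm {n d : ℕ} (Y : Matrix (Fin n) (Fin d) ℝ) (v : EuclideanSpace ℝ (Fin n)) :
    ‖toEuclideanLin Yᵀ v‖ ^ 2 = v.ofLp ⬝ᵥ ((Y * Yᵀ) *ᵥ v.ofLp) := by
  rw [← real_inner_self_eq_norm_sq, EuclideanSpace.inner_eq_star_dotProduct]
  simp only [star_trivial, ofLp_toEuclideanLin_apply]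
  rw [← mulVec_mulVec, dotProduct_mulVec v.ofLp Y, mulVec_transpose]

lemma aux_orbit {n d : ℕ} (Y Z : Matrix (Fin n) (Fin d) ℝ) (h : Y * Yᵀ = Z * Zᵀ) :
    ∃ Q : Matrix (Fin d) (Fin d) ℝ, Q * Qᵀ = 1 ∧ Qᵀ * Q = 1 ∧ Y = Z * Q := by
  classical
  let A := toEuclideanLin Yᵀ
  let B := toEuclideanLin Zᵀ
  have hAB : ∀ v, ‖A v‖ = ‖B v‖ := by
    intro v
    have := aux_norm Y v
    rw [h, ← aux_norm Z v] at this
    exact (sq_eq_sq₀ (norm_nonneg _) (norm_nonneg _)).1 this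
  obtain ⟨g, hg⟩ := LinearMap.exists_rightInverse_of_surjective B.rangeRestrict
    B.range_rangeRestrict
  have hg' : ∀ s, B (g s) = s := fun s => congrArg Subtype.val (LinearMap.congr_fun hg s)
  let L : LinearMap.range B →ₗᵢ[ℝ] EuclideanSpace ℝ (Fin d) :=
    { toLinearMap := A ∘ₗ g
      norm_map' := fun s => by
        change ‖A (g s)‖ = ‖s‖
        rw [hAB, hg']; rfl }
  let E := L.extend
  have hE : ∀ v, E (B v) = A v := by
    intro v
    have h1 : E (B v) = A (g ⟨B v, v, rfl⟩) := L.extend_apply ⟨B v, v, rfl⟩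
    rw [h1, ← sub_eq_zero, ← map_sub, ← norm_eq_zero, hAB, map_sub, hg', sub_self, norm_zero]
  let W : Matrix (Fin d) (Fin d) ℝ := toEuclideanLin.symm E.toLinearMap
  have hW : ∀ v, toEuclideanLin W v = E v := fun v => by
    simp only [W, LinearEquiv.apply_symm_apply]; rfl
  have hWW : Wᵀ * W = 1 := by
    ext i j
    have key : inner ℝ (E (EuclideanSpace.single j (1:ℝ))) (E (EuclideanSpace.single i (1:ℝ)))
      = inner ℝ (EuclideanSpace.single j (1:ℝ)) (EuclideanSpace.single i (1:ℝ)) :=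
      E.inner_map_map _ _
    rw [← hW, ← hW, EuclideanSpace.inner_eq_star_dotProduct] at key
    simp only [star_trivial, ofLp_toEuclideanLin_apply] at key
    simp [mulVec_single_one, EuclideanSpace.inner_single_left] at key
    rw [mul_apply, one_apply]
    simpa [dotProduct, eq_comm] using key
  have hZ : W * Zᵀ = Yᵀ := by
    apply toEuclideanLin.injective
    ext1 v
    have : toEuclideanLin (W * Zᵀ) v = toEuclideanLin W (B v) := by
      simp [toEuclideanLin_apply, B, mulVec_mulVec]
    rw [this, hW, hE]
  refine ⟨Wᵀ, by simpa using hWW, by simpa using mul_eq_one_comm.1 hWW, ?_⟩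
  rw [← transpose_transpose Y, ← hZ, transpose_mul, transpose_transpose]

lemma aux_compact (n d : ℕ) :
    CompactSpace {Y : Matrix (Fin n) (Fin d) ℝ // ∀ i, (Y * Yᵀ) i i = 1} := by
  refine (isCompact_iff_compactSpace
    (s := {Y : Matrix (Fin n) (Fin d) ℝ | ∀ i, (Y * Yᵀ) i i = 1})).1 ?_
  have hK : IsCompact (Set.univ.pi fun _ => Set.univ.pi fun _ => Set.Icc (-1) 1 :
      Set (Fin n → Fin d → ℝ)) :=
    isCompact_univ_pi fun _ => isCompact_univ_pi fun _ => isCompact_Icc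
  refine IsCompact.of_isClosed_subset (X := Matrix (Fin n) (Fin d) ℝ) hK ?_ ?_
  · rw [Set.setOf_forall]
    refine isClosed_iInter fun i => isClosed_eq ?_ continuous_const
    exact Continuous.matrix_elem (by fun_prop) i i
  · intro Y hY i _ j _
    have h1 := hY i
    rw [mul_apply] at h1
    have h2 : Y i j * Y i j ≤ 1 := by
      rw [← h1]
      exact Finset.single_le_sum (f := fun j => Y i j * Yᵀ j i)
        (fun k _ => mul_self_nonneg (Y i k)) (Finset.mem_univ j)
    exact abs_le.1 (abs_le_one_iff_mul_self_le_one.2 h2)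

/-- Let `T_{n,d}` be the space of real `n × d` matrices with unit-norm rows (subspace
topology) and let `s` be the setoid on `T_{n,d}` whose equivalence classes are the orbits
of the right action of the orthogonal group `O_d`, `(Y, Q) ↦ Y * Q`.  Then the map
`Ψ : T_{n,d}/O_d → C_{n,d}`, `Ψ [Y] = Y * Yᵀ`, is well defined and is a homeomorphism of
the quotient space (with the quotient topology) onto `C_{n,d}`, the space of positive
semidefinite matrices with unit diagonal and rank at most `d` (subspace topology). -/
theorem quotient_homeomorph_lowrank_correlation (n d : ℕ) (hn : 0 < n) (hd : 0 < d)
    (hdn : d ≤ n)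
    (s : Setoid {Y : Matrix (Fin n) (Fin d) ℝ // ∀ i, (Y * Yᵀ) i i = 1})
    (hs : ∀ Y Z : {Y : Matrix (Fin n) (Fin d) ℝ // ∀ i, (Y * Yᵀ) i i = 1},
      s.r Y Z ↔ ∃ Q : Matrix (Fin d) (Fin d) ℝ, Q * Qᵀ = 1 ∧ Qᵀ * Q = 1 ∧
        (Y : Matrix (Fin n) (Fin d) ℝ) = (Z : Matrix (Fin n) (Fin d) ℝ) * Q) :
    ∃ Ψ : Quotient s ≃ₜ
        {X : Matrix (Fin n) (Fin n) ℝ // X.PosSemidef ∧ (∀ i, X i i = 1) ∧ X.rank ≤ d},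
      ∀ Y : {Y : Matrix (Fin n) (Fin d) ℝ // ∀ i, (Y * Yᵀ) i i = 1},
        (Ψ (Quotient.mk s Y) : Matrix (Fin n) (Fin n) ℝ) =
          (Y : Matrix (Fin n) (Fin d) ℝ) * (Y : Matrix (Fin n) (Fin d) ℝ)ᵀ := by
  haveI := aux_compact n d
  let f : {Y : Matrix (Fin n) (Fin d) ℝ // ∀ i, (Y * Yᵀ) i i = 1} →
      {X : Matrix (Fin n) (Fin n) ℝ // X.PosSemidef ∧ (∀ i, X i i = 1) ∧ X.rank ≤ d} :=
    fun Y => ⟨Y.1 * Y.1ᵀ, by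
      simpa using posSemidef_self_mul_conjTranspose Y.1, Y.2, by
      rw [rank_self_mul_transpose]
      simpa using Y.1.rank_le_width⟩
  have hf : Continuous f := by
    refine Continuous.subtype_mk ?_ _
    fun_prop
  have hwd : ∀ Y Z, s.r Y Z → f Y = f Z := by
    intro Y Z h
    obtain ⟨Q, h1, -, h3⟩ := (hs Y Z).1 h
    apply Subtype.ext
    change Y.1 * Y.1ᵀ = Z.1 * Z.1ᵀ
    rw [h3, transpose_mul, Matrix.mul_assoc, ← Matrix.mul_assoc Q, h1, Matrix.one_mul]
  let F : Quotient s → _ := Quotient.lift f hwd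
  have hF : Continuous F := hf.quotient_lift hwd
  have hbij : Function.Bijective F := by
    constructor
    · rintro ⟨Y⟩ ⟨Z⟩ h
      exact Quotient.sound ((hs Y Z).2 (aux_orbit Y.1 Z.1 (congrArg Subtype.val h)))
    · rintro ⟨X, h1, h2, h3⟩
      obtain ⟨Y, hY⟩ := aux_factor X h1 h3
      exact ⟨Quotient.mk s ⟨Y, by rw [hY]; exact h2⟩, Subtype.ext hY⟩
  exact ⟨Continuous.homeoOfEquivCompactToT2 (f := Equiv.ofBijective F hbij) hF, fun Y => rfl⟩
end

section
/- Let n, d be positive integers with d ≤ n. For every X in C_{n,d} there exists a matrix Y in Chol_{n,d} such that Y Yᵀ = X; that is, there exists a real n×d matrix Y with Y_{11} = 1, Y_{ij} = 0 whenever j > i, every row of Y of unit Euclidean norm, and Y Yᵀ = X. -/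
open Matrix

/-- A finite-dimensional inner product space of dimension at most `d` embeds in `ℝ^d`. -/
lemma exists_isometry_aux {S : Type*} [NormedAddCommGroup S] [InnerProductSpace ℝ S]
    [FiniteDimensional ℝ S] (d : ℕ) (h : Module.finrank ℝ S ≤ d) :
    ∃ L : S → EuclideanSpace ℝ (Fin d), ∀ x y, inner ℝ (L x) (L y) = inner ℝ x y := by
  let b := stdOrthonormalBasis ℝ S
  let g : Fin (Module.finrank ℝ S) → EuclideanSpace ℝ (Fin d) :=
    fun k => EuclideanSpace.basisFun (Fin d) ℝ (Fin.castLE h k)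
  have hg : Orthonormal ℝ g :=
    (EuclideanSpace.basisFun (Fin d) ℝ).orthonormal.comp _ (Fin.castLE_injective h)
  let L := b.toBasis.constr ℝ g
  have hb : Orthonormal ℝ b.toBasis := by simp
  have hL : Orthonormal ℝ (L ∘ b.toBasis) := by
    have : L ∘ b.toBasis = g := by
      funext k
      exact b.toBasis.constr_basis ℝ g k
    rw [this]; exact hg
  exact ⟨L.isometryOfOrthonormal hb hL, fun x y => LinearIsometry.inner_map_map _ x y⟩

/-- A positive semidefinite matrix of rank at most `d` is a Gram matrix of vectors in `ℝ^d`. -/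
lemma exists_gram_aux (n d : ℕ) (X : Matrix (Fin n) (Fin n) ℝ)
    (hX : X.PosSemidef) (hrank : X.rank ≤ d) :
    ∃ v : Fin n → EuclideanSpace ℝ (Fin d), ∀ i j, inner ℝ (v i) (v j) = X i j := by
  obtain ⟨B, hB⟩ : ∃ B : Matrix (Fin n) (Fin n) ℝ, X = Bᵀ * B := by
    open scoped MatrixOrder Matrix.Norms.L2Operator in
    obtain ⟨B, hB⟩ := CStarAlgebra.nonneg_iff_eq_star_mul_self.mp hX.nonneg
    exact ⟨B, by rw [hB, star_eq_conjTranspose, conjTranspose_eq_transpose_of_trivial]⟩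
  have hr : Module.finrank ℝ (Submodule.span ℝ (Set.range B.col)) ≤ d := by
    rw [← rank_eq_finrank_span_cols, ← rank_transpose_mul_self, ← hB]; exact hrank
  let e := (WithLp.linearEquiv 2 ℝ (Fin n → ℝ)).symm
  let S := (Submodule.span ℝ (Set.range B.col)).map e.toLinearMap
  have hS : Module.finrank ℝ S ≤ d := (LinearEquiv.finrank_map_eq e _).trans_le hr
  obtain ⟨L, hL⟩ := exists_isometry_aux (S := S) d hS
  refine ⟨fun i => L ⟨e (B.col i), Submodule.mem_map_of_mem
    (Submodule.subset_span ⟨i, rfl⟩)⟩, fun i j => ?_⟩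
  rw [hL, hB]
  simp [e, PiLp.inner_apply, Matrix.mul_apply, mul_comm]

/-- For every `X ∈ C_{n,d}` there exists `Y` in the Cholesky manifold `Chol_{n,d}`
(lower triangular with `Y₁₁ = 1` and unit-norm rows) such that `Y * Yᵀ = X`. -/
theorem exists_cholesky_factor (n d : ℕ) (hn : 0 < n) (hd : 0 < d) (hdn : d ≤ n)
    (X : Matrix (Fin n) (Fin n) ℝ)
    (hX : X.PosSemidef) (hdiag : ∀ i, X i i = 1) (hrank : X.rank ≤ d) :
    ∃ Y : Matrix (Fin n) (Fin d) ℝ,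
      Y ⟨0, hn⟩ ⟨0, hd⟩ = 1 ∧
      (∀ (i : Fin n) (j : Fin d), (i : ℕ) < (j : ℕ) → Y i j = 0) ∧
      (∀ i, (Y * Yᵀ) i i = 1) ∧
      Y * Yᵀ = X := by
  obtain ⟨v, hv⟩ := exists_gram_aux n d X hX hrank
  let b := InnerProductSpace.gramSchmidtOrthonormalBasis (𝕜 := ℝ)
    (E := EuclideanSpace ℝ (Fin d)) (ι := Fin d) (by simp) (fun j => v (Fin.castLE hdn j))
  let Z : Matrix (Fin n) (Fin d) ℝ := Matrix.of fun i j => inner ℝ (b j) (v i)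
  have hZ0 : ∀ (i : Fin n) (j : Fin d), (i : ℕ) < (j : ℕ) → Z i j = 0 := fun i j hij =>
    InnerProductSpace.gramSchmidtOrthonormalBasis_inv_triangular (𝕜 := ℝ) (by simp)
      (fun j => v (Fin.castLE hdn j)) (i := ⟨i, hij.trans j.2⟩) (j := j) hij
  have hZ : Z * Zᵀ = X := by
    ext i j
    rw [← hv i j, ← b.sum_inner_mul_inner]
    rw [Matrix.mul_apply]
    refine Finset.sum_congr rfl fun k _ => ?_
    rw [real_inner_comm (b k) (v i)]
    rfl
  have h1 : Z ⟨0, hn⟩ ⟨0, hd⟩ * Z ⟨0, hn⟩ ⟨0, hd⟩ = 1 := by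
    rw [← hdiag ⟨0, hn⟩, ← hZ, Matrix.mul_apply, Finset.sum_eq_single ⟨0, hd⟩]
    · rfl
    · intro j _ hj
      have : (0 : ℕ) < j := Nat.pos_of_ne_zero fun h => hj (Fin.ext h)
      rw [hZ0 ⟨0, hn⟩ j this, zero_mul]
    · simp
  have hY : (Z ⟨0, hn⟩ ⟨0, hd⟩ • Z) * (Z ⟨0, hn⟩ ⟨0, hd⟩ • Z)ᵀ = X := by
    rw [transpose_smul, Matrix.smul_mul, Matrix.mul_smul, smul_smul, h1, one_smul, hZ]
  refine ⟨Z ⟨0, hn⟩ ⟨0, hd⟩ • Z, h1, fun i j hij => ?_, fun i => ?_, hY⟩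
  · rw [Matrix.smul_apply, hZ0 i j hij, smul_zero]
  · rw [hY, hdiag]
end

section
/- Let n, d be positive integers with d ≤ n, let C be a real symmetric n×n matrix, and let Y be a real n×d matrix each of whose rows has unit Euclidean norm. Set ψ = Y Yᵀ − C and F_Y = 2 ψ Y, and suppose that F_Y − diag(F_Y Yᵀ) Y = 0 (the gradient of F(Y) = (1/2)‖Y Yᵀ − C‖_F² on T_{n,d} vanishes at Y). Define the diagonal matrix λ = (1/2) diag(F_Y Yᵀ). Then: (a) (C + λ − Y Yᵀ) Y = 0; (b) Y Yᵀ (C + λ − Y Yᵀ) = 0; (c) Y Yᵀ and C + λ commute: (Y Yᵀ)(C + λ) = (C + λ)(Y Yᵀ). -/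
open Matrix

/-- At a stationary point `Y` of `F(Y) = (1/2)‖Y Yᵀ - C‖_F²` on `T_{n,d}` (i.e.
`F_Y - diag(F_Y Yᵀ) Y = 0` with `F_Y = 2(Y Yᵀ - C) Y`), setting
`λ = (1/2) diag(F_Y Yᵀ)` one has: (a) `(C + λ - Y Yᵀ) Y = 0`;
(b) `Y Yᵀ (C + λ - Y Yᵀ) = 0`; (c) `Y Yᵀ` and `C + λ` commute. -/
theorem stationary_point_lagrange_identities (n d : ℕ) (hn : 0 < n) (hd : 0 < d)
    (hdn : d ≤ n)
    (C : Matrix (Fin n) (Fin n) ℝ) (hC : C.IsSymm)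
    (Y : Matrix (Fin n) (Fin d) ℝ) (hY : ∀ i, (Y * Yᵀ) i i = 1)
    (FY : Matrix (Fin n) (Fin d) ℝ)
    (hFY : FY = (2 : ℝ) • ((Y * Yᵀ - C) * Y))
    (hstat : FY - Matrix.diagonal (fun i => (FY * Yᵀ) i i) * Y = 0)
    (Λ : Matrix (Fin n) (Fin n) ℝ)
    (hΛ : Λ = Matrix.diagonal (fun i => (1 / 2 : ℝ) * (FY * Yᵀ) i i)) :
    (C + Λ - Y * Yᵀ) * Y = 0 ∧
    Y * Yᵀ * (C + Λ - Y * Yᵀ) = 0 ∧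
    (Y * Yᵀ) * (C + Λ) = (C + Λ) * (Y * Yᵀ) := by
  have hΛs : Λᵀ = Λ := by rw [hΛ, Matrix.diagonal_transpose]
  have ha : (C + Λ - Y * Yᵀ) * Y = 0 := by
    have h1 : Λ * Y = (Y * Yᵀ - C) * Y := by
      ext i j
      have h2 := congrFun (congrFun hstat i) j
      have h3 := congrFun (congrFun hFY i) j
      rw [Matrix.sub_apply, Matrix.diagonal_mul, Matrix.zero_apply] at h2
      rw [Matrix.smul_apply, smul_eq_mul] at h3
      rw [hΛ, Matrix.diagonal_mul]
      linarith
    have h4 : C + Λ - Y * Yᵀ = Λ - (Y * Yᵀ - C) := by abel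
    rw [h4, Matrix.sub_mul, h1, sub_self]
  have hs : (C + Λ - Y * Yᵀ)ᵀ = C + Λ - Y * Yᵀ := by
    rw [Matrix.transpose_sub, Matrix.transpose_add, hC.eq, hΛs, Matrix.transpose_mul,
      Matrix.transpose_transpose]
  have hb' : Yᵀ * (C + Λ - Y * Yᵀ) = 0 := by
    have h := congrArg Matrix.transpose ha
    rwa [Matrix.transpose_mul, hs, Matrix.transpose_zero] at h
  have hb : Y * Yᵀ * (C + Λ - Y * Yᵀ) = 0 := by
    rw [Matrix.mul_assoc, hb', Matrix.mul_zero]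
  refine ⟨ha, hb, ?_⟩
  have hc : (C + Λ - Y * Yᵀ) * (Y * Yᵀ) = 0 := by
    rw [← Matrix.mul_assoc, ha, Matrix.zero_mul]
  rw [Matrix.mul_sub, sub_eq_zero] at hb
  rw [Matrix.sub_mul, sub_eq_zero] at hc
  rw [hb, hc]
end

section
/- Let n, d be positive integers with d ≤ n, let C be a real symmetric n×n matrix, and let Y be a real n×d matrix each of whose rows has unit Euclidean norm. Set ψ = Y Yᵀ − C and F_Y = 2 ψ Y, suppose F_Y − diag(F_Y Yᵀ) Y = 0, and define the diagonal matrix λ = (1/2) diag(F_Y Yᵀ). Then C + λ and Y Yᵀ admit a joint eigenvalue decomposition: there exist a real orthogonal n×n matrix Q and real diagonal n×n matrices D and D* such that C + λ = Q D Qᵀ, Y Yᵀ = Q D* Qᵀ, for each index i either D*_{ii} = 0 or D*_{ii} = D_{ii} ≥ 0, and the number of indices i with D*_{ii} ≠ 0 is at most d. -/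
open Matrix

/-- A nonzero vector with `M v = μ v` witnesses that `μ` lies in the spectrum. -/
lemma mem_spectrum_of_mulVec {n : ℕ} (M : Matrix (Fin n) (Fin n) ℝ) (v : Fin n → ℝ) (μ : ℝ)
    (hv : v ≠ 0) (h : M *ᵥ v = μ • v) : μ ∈ spectrum ℝ M := by
  rw [← Matrix.spectrum_toLin']
  apply Module.End.HasEigenvalue.mem_spectrum
  apply Module.End.hasEigenvalue_of_hasEigenvector (x := v)
  refine ⟨?_, hv⟩
  rw [Module.End.mem_eigenspace_iff, Matrix.toLin'_apply, h]

/-- Symmetric matrices with zero product are jointly diagonalizable. -/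
lemma joint_diag {n : ℕ} (E B : Matrix (Fin n) (Fin n) ℝ) (hE : Eᵀ = E) (hB : Bᵀ = B)
    (hEB : E * B = 0) (hBE : B * E = 0) :
    ∃ (Q : Matrix (Fin n) (Fin n) ℝ) (e b : Fin n → ℝ), Q * Qᵀ = 1 ∧ Qᵀ * Q = 1 ∧
      E * Q = Q * diagonal e ∧ B * Q = Q * diagonal b ∧ ∀ i, e i = 0 ∨ b i = 0 := by
  have hEh : E.IsHermitian := by rw [IsHermitian, conjTranspose_eq_transpose_of_trivial, hE]
  have hfin : (insert (0 : ℝ) (Set.image2 (fun x y => x / y) (spectrum ℝ E)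
      (spectrum ℝ B))).Finite :=
    (Set.Finite.image2 _ (finite_real_spectrum) (finite_real_spectrum)).insert 0
  obtain ⟨t, ht⟩ := hfin.exists_notMem
  simp only [Set.mem_insert_iff, not_or] at ht
  obtain ⟨ht0, ht⟩ := ht
  have hM : (E + t • B).IsHermitian := by
    rw [IsHermitian, conjTranspose_eq_transpose_of_trivial, transpose_add, transpose_smul, hE, hB]
  have key : ∀ (v : Fin n → ℝ) (μ : ℝ), (E + t • B) *ᵥ v = μ • v →
      ∃ e b : ℝ, E *ᵥ v = e • v ∧ B *ᵥ v = b • v ∧ (e = 0 ∨ b = 0) := by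
    intro v μ h
    have h1 : E *ᵥ v + t • (B *ᵥ v) = μ • v := by
      rw [← h, add_mulVec, smul_mulVec]
    have hEE : E *ᵥ (E *ᵥ v) = μ • (E *ᵥ v) := by
      have := congrArg (fun w => E *ᵥ w) h1
      simpa [mulVec_add, mulVec_smul, mulVec_mulVec, hEB] using this
    have hBB : t • (B *ᵥ (B *ᵥ v)) = μ • (B *ᵥ v) := by
      have := congrArg (fun w => B *ᵥ w) h1
      simpa [mulVec_add, mulVec_smul, mulVec_mulVec, hBE] using this
    have hBB' : B *ᵥ (B *ᵥ v) = (μ / t) • (B *ᵥ v) := by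
      rw [div_eq_inv_mul, mul_smul, ← hBB, smul_smul, inv_mul_cancel₀ ht0, one_smul]
    by_cases hu : E *ᵥ v = 0
    · refine ⟨0, μ / t, by simp [hu], ?_, Or.inl rfl⟩
      rw [hu, zero_add] at h1
      rw [div_eq_inv_mul, mul_smul, ← h1, smul_smul, inv_mul_cancel₀ ht0, one_smul]
    by_cases hw : B *ᵥ v = 0
    · refine ⟨μ, 0, ?_, by simp [hw], Or.inr rfl⟩
      rw [← h1, hw, smul_zero, add_zero]
    exfalso
    by_cases hμ : μ = 0
    · subst hμ
      apply hu
      rw [zero_smul] at hEE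
      have h2 : (E *ᵥ v) ⬝ᵥ (E *ᵥ v) = 0 := by
        have h3 : v ⬝ᵥ (E *ᵥ (E *ᵥ v)) = 0 := by rw [hEE, dotProduct_zero]
        rw [dotProduct_mulVec, ← mulVec_transpose, hE] at h3
        exact h3
      exact dotProduct_self_eq_zero.mp h2
    · apply ht
      refine ⟨μ, mem_spectrum_of_mulVec E _ μ hu hEE, μ / t,
        mem_spectrum_of_mulVec B _ _ hw hBB', ?_⟩
      field_simp
  set Q : Matrix (Fin n) (Fin n) ℝ := (hM.eigenvectorUnitary : Matrix (Fin n) (Fin n) ℝ) with hQ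
  have hstar : star Q = Qᵀ := by
    rw [star_eq_conjTranspose, conjTranspose_eq_transpose_of_trivial]
  have hcol : ∀ j, (E + t • B) *ᵥ (Q.col j) = hM.eigenvalues j • Q.col j := by
    intro j
    rw [hQ, hM.eigenvectorUnitary_col_eq]
    exact hM.mulVec_eigenvectorBasis j
  choose e b he hb heb using fun j => key _ _ (hcol j)
  refine ⟨Q, e, b, ?_, ?_, ?_, ?_, heb⟩
  · rw [← hstar]; exact Unitary.coe_mul_star_self hM.eigenvectorUnitary
  · rw [← hstar]; exact Unitary.coe_star_mul_self hM.eigenvectorUnitary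
  · ext i j
    have := congrFun (he j) i
    rw [mul_diagonal, mul_comm]
    exact this
  · ext i j
    have := congrFun (hb j) i
    rw [mul_diagonal, mul_comm]
    exact this

/-- At a stationary point `Y` of `F(Y) = (1/2)‖Y Yᵀ - C‖_F²` on `T_{n,d}`, with
`λ = (1/2) diag(F_Y Yᵀ)`, the matrices `C + λ` and `Y Yᵀ` admit a joint eigenvalue
decomposition `C + λ = Q D Qᵀ`, `Y Yᵀ = Q D* Qᵀ` with `Q` orthogonal, where `D*` is
obtained from `D` by selecting at most `d` nonnegative entries (retaining their
positions) and setting the remaining entries to zero. -/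
theorem joint_eigendecomposition_at_stationary_point (n d : ℕ) (hn : 0 < n) (hd : 0 < d)
    (hdn : d ≤ n)
    (C : Matrix (Fin n) (Fin n) ℝ) (hC : C.IsSymm)
    (Y : Matrix (Fin n) (Fin d) ℝ) (hY : ∀ i, (Y * Yᵀ) i i = 1)
    (FY : Matrix (Fin n) (Fin d) ℝ)
    (hFY : FY = (2 : ℝ) • ((Y * Yᵀ - C) * Y))
    (hstat : FY - Matrix.diagonal (fun i => (FY * Yᵀ) i i) * Y = 0)
    (Λ : Matrix (Fin n) (Fin n) ℝ)
    (hΛ : Λ = Matrix.diagonal (fun i => (1 / 2 : ℝ) * (FY * Yᵀ) i i)) :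
    ∃ (Q : Matrix (Fin n) (Fin n) ℝ) (D Dstar : Fin n → ℝ),
      Q * Qᵀ = 1 ∧ Qᵀ * Q = 1 ∧
      C + Λ = Q * Matrix.diagonal D * Qᵀ ∧
      Y * Yᵀ = Q * Matrix.diagonal Dstar * Qᵀ ∧
      (∀ i, Dstar i = 0 ∨ (Dstar i = D i ∧ 0 ≤ D i)) ∧
      (Finset.univ.filter fun i => Dstar i ≠ 0).card ≤ d := by
  have hAY : (C + Λ) * Y = Y * Yᵀ * Y := by
    have h2 : Λ = (1 / 2 : ℝ) • Matrix.diagonal (fun i => (FY * Yᵀ) i i) := by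
      rw [hΛ, ← diagonal_smul]; rfl
    have h3 : Λ * Y = (Y * Yᵀ - C) * Y := by
      rw [h2, smul_mul, ← sub_eq_zero.mp hstat, hFY, smul_smul]; norm_num
    rw [Matrix.add_mul, h3, Matrix.sub_mul]; abel
  have hB : (Y * Yᵀ)ᵀ = Y * Yᵀ := by rw [transpose_mul, transpose_transpose]
  have hE : (C + Λ - Y * Yᵀ)ᵀ = C + Λ - Y * Yᵀ := by
    rw [transpose_sub, hB, transpose_add, hC, hΛ, diagonal_transpose]
  have hEB : (C + Λ - Y * Yᵀ) * (Y * Yᵀ) = 0 := by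
    rw [← Matrix.mul_assoc, Matrix.sub_mul, hAY, sub_self, Matrix.zero_mul]
  have hBE : (Y * Yᵀ) * (C + Λ - Y * Yᵀ) = 0 := by
    have := congrArg transpose hEB
    rwa [transpose_mul, hB, hE, transpose_zero] at this
  obtain ⟨Q, e, b, h1, h2, he, hb, heb⟩ := joint_diag _ _ hE hB hEB hBE
  have hb' : Y * Yᵀ = Q * diagonal b * Qᵀ := by
    rw [← hb, Matrix.mul_assoc, h1, Matrix.mul_one]
  have he' : C + Λ - Y * Yᵀ = Q * diagonal e * Qᵀ := by
    rw [← he, Matrix.mul_assoc, h1, Matrix.mul_one]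
  have hdiag : diagonal b = Qᵀ * (Y * Yᵀ) * Q := by
    rw [Matrix.mul_assoc, hb, ← Matrix.mul_assoc, h2, Matrix.one_mul]
  have hpos : ∀ i, 0 ≤ b i := by
    intro i
    have h4 : diagonal b = (Yᵀ * Q)ᵀ * (Yᵀ * Q) := by
      rw [hdiag, transpose_mul, transpose_transpose]; simp only [Matrix.mul_assoc]
    have h5 := congrFun (congrFun h4 i) i
    rw [diagonal_apply_eq, Matrix.mul_apply] at h5
    rw [h5]
    exact Finset.sum_nonneg fun k _ => mul_self_nonneg _
  refine ⟨Q, fun i => e i + b i, b, h1, h2, ?_, hb', ?_, ?_⟩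
  · rw [← diagonal_add, Matrix.mul_add, Matrix.add_mul, ← he', ← hb', sub_add_cancel]
  · intro i
    rcases heb i with h | h
    · right
      simp [h, hpos i]
    · exact Or.inl h
  · have hr : (diagonal b).rank ≤ d := by
      rw [hdiag]
      calc (Qᵀ * (Y * Yᵀ) * Q).rank ≤ (Qᵀ * (Y * Yᵀ)).rank := rank_mul_le_left _ _
        _ ≤ (Y * Yᵀ).rank := rank_mul_le_right _ _
        _ ≤ Y.rank := rank_mul_le_left _ _
        _ ≤ d := by simpa using rank_le_card_width Y
    rw [rank_diagonal, Fintype.card_subtype] at hr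
    convert hr
end

section
/- Let n, d be positive integers with d ≤ n, let C be a real symmetric n×n matrix with unit diagonal, and let λ* ∈ ℝⁿ with associated diagonal matrix Λ* = diag(λ*). Suppose X* is a real symmetric n×n matrix with rank(X*) ≤ d that is a best rank-d approximation of C + Λ* in the Frobenius norm among symmetric matrices, i.e. ‖(C + Λ*) − X*‖_F ≤ ‖(C + Λ*) − X‖_F for all real symmetric n×n matrices X with rank(X) ≤ d, and suppose in addition that X* ∈ C_{n,d} (X* is positive semidefinite with unit diagonal). Then X* is a global minimizer of the distance to C over C_{n,d}: ‖C − X*‖_F ≤ ‖C − X‖_F for every X ∈ C_{n,d}. -/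
open Matrix

/-- The Frobenius norm of a real matrix. -/
noncomputable def frobNorm {m k : ℕ} (A : Matrix (Fin m) (Fin k) ℝ) : ℝ :=
  Real.sqrt (∑ i, ∑ j, (A i j) ^ 2)

theorem frob_shift_aux {n : ℕ} (C X : Matrix (Fin n) (Fin n) ℝ) (lam : Fin n → ℝ)
    (h : ∀ i, C i i = X i i) :
    ∑ i, ∑ j, ((C + Matrix.diagonal lam - X) i j) ^ 2
      = ∑ i, ∑ j, ((C - X) i j) ^ 2 + ∑ i, lam i ^ 2 := by
  rw [← Finset.sum_add_distrib]
  refine Finset.sum_congr rfl fun i _ => ?_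
  have h2 : lam i ^ 2 = ∑ j, if i = j then lam i ^ 2 else 0 := by simp
  rw [h2, ← Finset.sum_add_distrib]
  refine Finset.sum_congr rfl fun j _ => ?_
  by_cases hij : i = j
  · subst hij
    simp [h i]
  · simp [hij]

/-- (Characterization of the global minimum.)  If `X*` is a symmetric matrix of rank at
most `d` that is a best rank-`d` approximation of `C + diag(λ*)` in the Frobenius norm
among symmetric matrices, and `X* ∈ C_{n,d}` (positive semidefinite with unit diagonal),
then `X*` globally minimizes `‖C - X‖_F` over `C_{n,d}`. -/
theorem global_minimum_characterization (n d : ℕ) (hn : 0 < n) (hd : 0 < d) (hdn : d ≤ n)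
    (C : Matrix (Fin n) (Fin n) ℝ) (hC : C.IsSymm) (hCdiag : ∀ i, C i i = 1)
    (lam : Fin n → ℝ)
    (Xstar : Matrix (Fin n) (Fin n) ℝ) (hXsymm : Xstar.IsSymm) (hXrank : Xstar.rank ≤ d)
    (hbest : ∀ X : Matrix (Fin n) (Fin n) ℝ, X.IsSymm → X.rank ≤ d →
      frobNorm (C + Matrix.diagonal lam - Xstar) ≤ frobNorm (C + Matrix.diagonal lam - X))
    (hXpsd : Xstar.PosSemidef) (hXdiag : ∀ i, Xstar i i = 1) :
    ∀ X : Matrix (Fin n) (Fin n) ℝ,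
      X.PosSemidef → (∀ i, X i i = 1) → X.rank ≤ d →
      frobNorm (C - Xstar) ≤ frobNorm (C - X) := by
  intro X hX hXd hXr
  have hs : X.IsSymm := by
    have := hX.isHermitian
    rwa [Matrix.IsHermitian, Matrix.conjTranspose_eq_transpose_of_trivial] at this
  have hb := hbest X hs hXr
  unfold frobNorm at hb ⊢
  rw [frob_shift_aux C Xstar lam (fun i => by rw [hCdiag, hXdiag]),
    frob_shift_aux C X lam (fun i => by rw [hCdiag, hXd]),
    Real.sqrt_le_sqrt_iff (by positivity)] at hb
  exact Real.sqrt_le_sqrt (by linarith)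
end
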